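/- If β = d/(2R_S) ∈ [√3/2, 1], then the area of an equilateral triangle of side d covered by three disks of radius R_S centered at its vertices equals R_S²·(π/2 − 3·arccos(β) + 3β·√(1−β²)). -/

import Mathlib

open Real MeasureTheory Metric

lemma aux_deriv (R y : ℝ) (hR : 0 < R) (h : y ^ 2 < R ^ 2) :
    HasDerivAt (fun y => (y * √(R ^ 2 - y ^ 2) + R ^ 2 * arcsin (y / R)) / 2) (√(R ^ 2 - y ^ 2)) y := by
  have hp : 0 < R ^ 2 - y ^ 2 := by linarith
  have habs := abs_lt_of_sq_lt_sq' h hR.le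
  have h1 : HasDerivAt (fun y => R ^ 2 - y ^ 2) (-(2 * y)) y := by
    simpa using (hasDerivAt_pow 2 y).const_sub (R ^ 2)
  have h2 := h1.sqrt hp.ne'
  have h3 : HasDerivAt (fun y => arcsin (y / R)) (1 / √(1 - (y / R) ^ 2) * (1 / R)) y := by
    refine (hasDerivAt_arcsin ?_ ?_).comp y ((hasDerivAt_id y).div_const R)
    · rw [ne_eq, div_eq_iff hR.ne']; intro h; linarith [habs.1]
    · rw [ne_eq, div_eq_iff hR.ne']; intro h; linarith [habs.2]
  have h4 := (((hasDerivAt_id y).mul h2).add (h3.const_mul (R ^ 2))).div_const 2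
  have e : √(1 - (y / R) ^ 2) = √(R ^ 2 - y ^ 2) / R := by
    rw [show 1 - (y / R) ^ 2 = (R ^ 2 - y ^ 2) / R ^ 2 by field_simp, sqrt_div hp.le, sqrt_sq hR.le]
  refine HasDerivAt.congr_deriv h4 ?_
  rw [e]
  have hs : 0 < √(R ^ 2 - y ^ 2) := sqrt_pos.2 hp
  have hq : √(R ^ 2 - y ^ 2) ^ 2 = R ^ 2 - y ^ 2 := sq_sqrt hp.le
  simp only [id]
  generalize √(R ^ 2 - y ^ 2) = t at *
  field_simp
  linear_combination -hq

lemma aux_int (R β : ℝ) (hR : 0 < R) (h1 : √3 / 2 ≤ β) (h2 : β ≤ 1) :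
    ∫ y in (0)..(R / 2), (min (β * R) (√(R ^ 2 - y ^ 2)) - √3 * y) =
      R ^ 2 * (π / 12 - arccos β / 2 + β * √(1 - β ^ 2) / 2) := by
  have s0 : 0 < √3 := by positivity
  have s3 : √3 ^ 2 = 3 := sq_sqrt (by norm_num)
  have hβ : 0 < β := by linarith
  set t := √(1 - β ^ 2) with ht
  have t0 : 0 ≤ t := sqrt_nonneg _
  have tt : t ^ 2 = 1 - β ^ 2 := sq_sqrt (by nlinarith)
  have t1 : t ≤ 1 / 2 := by nlinarith
  have hc : Continuous fun y : ℝ => (min (β * R) (√(R ^ 2 - y ^ 2)) - √3 * y) := by fun_prop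
  rw [← intervalIntegral.integral_add_adjacent_intervals (b := t * R)
    (hc.intervalIntegrable _ _) (hc.intervalIntegrable _ _)]
  have i1 : ∫ y in (0)..(t * R), (min (β * R) (√(R ^ 2 - y ^ 2)) - √3 * y) =
      β * R * (t * R) - √3 * (t * R) ^ 2 / 2 := by
    rw [intervalIntegral.integral_congr (g := fun y => β * R - √3 * y)]
    · rw [intervalIntegral.integral_sub (by simp) (by apply Continuous.intervalIntegrable; fun_prop)]
      rw [intervalIntegral.integral_const_mul (√3) (fun y : ℝ => y)]
      simp; ring
    · intro y hy
      rw [Set.uIcc_of_le (by positivity)] at hy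
      simp only
      rw [min_eq_left]
      apply le_sqrt_of_sq_le
      have := pow_le_pow_left₀ hy.1 hy.2 2
      nlinarith
  have i2 : ∫ y in (t * R)..(R / 2), (min (β * R) (√(R ^ 2 - y ^ 2)) - √3 * y) =
      ((R / 2 * √(R ^ 2 - (R / 2) ^ 2) + R ^ 2 * arcsin (R / 2 / R)) / 2 - √3 * (R / 2) ^ 2 / 2) -
      ((t * R * √(R ^ 2 - (t * R) ^ 2) + R ^ 2 * arcsin (t * R / R)) / 2 - √3 * (t * R) ^ 2 / 2) := by
    rw [intervalIntegral.integral_congr (g := fun y => √(R ^ 2 - y ^ 2) - √3 * y)]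
    · refine intervalIntegral.integral_eq_sub_of_hasDerivAt (f := fun y => (y * √(R ^ 2 - y ^ 2) + R ^ 2 * arcsin (y / R)) / 2 - √3 * y ^ 2 / 2) ?_ ?_
      · intro y hy
        rw [Set.uIcc_of_le (by nlinarith)] at hy
        have hy0 : 0 ≤ y := le_trans (by positivity) hy.1
        refine (aux_deriv R y hR (by nlinarith [hy.2])).sub ?_
        have := (((hasDerivAt_pow 2 y).const_mul (√3)).div_const 2)
        refine this.congr_deriv ?_
        simp; ring
      · apply Continuous.intervalIntegrable; fun_prop
    · intro y hy
      rw [Set.uIcc_of_le (by nlinarith)] at hy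
      simp only
      rw [min_eq_right]
      apply sqrt_le_iff.2 ⟨by positivity, ?_⟩
      have := pow_le_pow_left₀ (by positivity) hy.1 2
      nlinarith
  have e1 : √(R ^ 2 - (R / 2) ^ 2) = √3 / 2 * R := by
    rw [show R ^ 2 - (R / 2) ^ 2 = (√3 / 2 * R) ^ 2 by rw [mul_pow, div_pow (√3), s3]; ring]
    exact sqrt_sq (by positivity)
  have e2 : √(R ^ 2 - (t * R) ^ 2) = β * R := by
    rw [show R ^ 2 - (t * R) ^ 2 = (β * R) ^ 2 by rw [mul_pow, tt]; ring]
    exact sqrt_sq (by positivity)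
  have e3 : arcsin (R / 2 / R) = π / 6 := by
    rw [show R / 2 / R = sin (π / 6) by rw [sin_pi_div_six]; field_simp]
    apply arcsin_sin <;> linarith [pi_pos]
  have e4 : arcsin (t * R / R) = arccos β := by
    rw [mul_div_cancel_right₀ _ hR.ne', arccos_eq_arcsin hβ.le]
  rw [i1, i2, e1, e2, e3, e4]
  ring

lemma aux_region (R β : ℝ) (hR : 0 < R) (h1 : √3 / 2 ≤ β) (h2 : β ≤ 1) :
    volume (regionBetween (fun y : ℝ => √3 * y) (fun y => min (β * R) (√(R ^ 2 - y ^ 2)))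
      (Set.Ico 0 (R / 2))) = 
      ENNReal.ofReal (R ^ 2 * (π / 12 - arccos β / 2 + β * √(1 - β ^ 2) / 2)) := by
  have s0 : 0 < √3 := by positivity
  have s3 : √3 ^ 2 = 3 := sq_sqrt (by norm_num)
  rw [Measure.volume_eq_prod, volume_regionBetween_eq_integral, ← aux_int R β hR h1 h2,
    intervalIntegral.integral_of_le (by positivity), ← integral_Icc_eq_integral_Ioc,
    integral_Icc_eq_integral_Ico]
  · rfl
  · exact ((by fun_prop : Continuous fun y : ℝ => √3 * y).integrableOn_Icc (a := 0) (b := R / 2)).mono_set Set.Ico_subset_Icc_self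
  · exact ((by fun_prop : Continuous fun y : ℝ => min (β * R) (√(R ^ 2 - y ^ 2))).integrableOn_Icc (a := 0) (b := R / 2)).mono_set Set.Ico_subset_Icc_self
  · exact measurableSet_Ico
  · intro y hy
    refine le_min ?_ ?_
    · nlinarith [hy.1, hy.2]
    · apply le_sqrt_of_sq_le
      rw [mul_pow, s3]; nlinarith [hy.1, hy.2]

/-- The part of the covered triangle where `A` is nearest and `C` is farthest. -/
def cell (R : ℝ) (A B C : (EuclideanSpace ℝ (Fin 2))) : Set (EuclideanSpace ℝ (Fin 2)) :=
  {p | p ∈ convexHull ℝ {A, B, C} ∧ dist p A < R ∧ dist p A < dist p B ∧ dist p B < dist p C}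

lemma cell_meas (R : ℝ) (A B C : (EuclideanSpace ℝ (Fin 2))) : MeasurableSet (cell R A B C) := by
  have h : MeasurableSet (convexHull ℝ ({A, B, C} : Set (EuclideanSpace ℝ (Fin 2)))) :=
    (Set.Finite.isClosed_convexHull ℝ (Set.toFinite _)).measurableSet
  have hl : ∀ P Q : (EuclideanSpace ℝ (Fin 2)), MeasurableSet {p : (EuclideanSpace ℝ (Fin 2)) | dist p P < dist p Q} := fun P Q =>
    (isOpen_lt (by fun_prop) (by fun_prop)).measurableSet
  have hb : MeasurableSet {p : (EuclideanSpace ℝ (Fin 2)) | dist p A < R} :=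
    (isOpen_lt (by fun_prop) (by fun_prop)).measurableSet
  exact h.inter (hb.inter ((hl A B).inter (hl B C)))

lemma exists_frame (d : ℝ) (hd : 0 < d) (A B C : (EuclideanSpace ℝ (Fin 2)))
    (hAB : dist A B = d) (hBC : dist B C = d) (hAC : dist A C = d) :
    ∃ b : OrthonormalBasis (Fin 2) ℝ (EuclideanSpace ℝ (Fin 2)), B = A + d • b 1 ∧
      C = A + ((√3 * d / 2) • b 0 + (d / 2) • b 1) := by
  have s0 : 0 < √3 := by positivity
  have s3 : √3 * √3 = 3 := mul_self_sqrt (by norm_num)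
  obtain ⟨u, rfl⟩ : ∃ u, B = A + u := ⟨B - A, by abel⟩
  obtain ⟨w, rfl⟩ : ∃ w, C = A + w := ⟨C - A, by abel⟩
  simp only [dist_self_add_right, dist_add_left] at hAB hBC hAC
  rw [dist_eq_norm] at hBC
  have huu : inner ℝ u u = d ^ 2 := by rw [real_inner_self_eq_norm_sq, hAB]
  have hww : inner ℝ w w = d ^ 2 := by rw [real_inner_self_eq_norm_sq, hAC]
  have huw : inner ℝ u w = d ^ 2 / 2 := by
    have := norm_sub_sq_real u w
    rw [hAB, hAC, hBC] at this; linarith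
  have hwu : inner ℝ w u = d ^ 2 / 2 := by rw [real_inner_comm, huw]
  have ho : Orthonormal ℝ ![(2 / (√3 * d)) • w - (1 / (√3 * d)) • u, (1 / d) • u] := by
    rw [orthonormal_iff_ite]
    intro i j
    fin_cases i <;> fin_cases j <;>
      simp only [inner_sub_left, inner_sub_right, inner_smul_left, inner_smul_right, huu, hww, huw, hwu,
        Fin.zero_eta, Fin.mk_one, Matrix.cons_val_zero, Matrix.cons_val_one, conj_trivial] <;>
      simp <;> field_simp <;> grind
  let b := OrthonormalBasis.mk ho (by
    have := ho.linearIndependent.span_eq_top_of_card_eq_finrank (by simp)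
    rw [this])
  have hb : (b : Fin 2 → (EuclideanSpace ℝ (Fin 2))) = _ := OrthonormalBasis.coe_mk ho _
  refine ⟨b, ?_, ?_⟩
  · rw [hb]
    simp [smul_smul, hd.ne']
  · rw [hb]
    simp only [Matrix.cons_val_zero, Matrix.cons_val_one, smul_sub, smul_smul]
    congr 1
    rw [show √3 * d / 2 * (2 / (√3 * d)) = 1 by field_simp,
      show √3 * d / 2 * (1 / (√3 * d)) = 1 / 2 by field_simp,
      show d / 2 * (1 / d) = 1 / 2 by field_simp]
    module

lemma frame_dist (b : OrthonormalBasis (Fin 2) ℝ (EuclideanSpace ℝ (Fin 2))) (A : (EuclideanSpace ℝ (Fin 2))) (x y x' y' : ℝ) :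
    dist (A + (y • b 0 + x • b 1)) (A + (y' • b 0 + x' • b 1)) = √((y - y') ^ 2 + (x - x') ^ 2) := by
  rw [dist_add_left, dist_eq_norm]
  rw [show y • b 0 + x • b 1 - (y' • b 0 + x' • b 1) = (y - y') • b 0 + (x - x') • b 1 by module]
  rw [eq_comm, sqrt_eq_iff_mul_self_eq (by positivity) (norm_nonneg _), 
    ← real_inner_self_eq_norm_mul_norm]
  simp only [inner_add_left, inner_add_right, inner_smul_left, inner_smul_right, 
    b.inner_eq_ite]
  simp; ring

lemma frame_mp (b : OrthonormalBasis (Fin 2) ℝ (EuclideanSpace ℝ (Fin 2))) (A : (EuclideanSpace ℝ (Fin 2))) :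
    MeasurePreserving (fun q : ℝ × ℝ => A + (q.1 • b 0 + q.2 • b 1)) := by
  have h := (measurePreserving_add_left (volume : Measure (EuclideanSpace ℝ (Fin 2))) A).comp
    ((b.measurePreserving_repr_symm).comp ((PiLp.volume_preserving_toLp (Fin 2)).comp
      ((volume_preserving_finTwoArrow ℝ).symm _)))
  have e : (fun q : ℝ × ℝ => A + (q.1 • b 0 + q.2 • b 1)) = 
      (fun x => A + x) ∘ ⇑b.repr.symm ∘ WithLp.toLp 2 ∘ ⇑MeasurableEquiv.finTwoArrow.symm := by
    ext1 q
    simp only [Function.comp]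
    rw [← b.sum_repr_symm, Fin.sum_univ_two]
    rfl
  rw [e]
  exact h

lemma frame_hull (d : ℝ) (hd : 0 < d) (b : OrthonormalBasis (Fin 2) ℝ (EuclideanSpace ℝ (Fin 2))) (A : (EuclideanSpace ℝ (Fin 2))) (x y : ℝ)
    (hy : 0 ≤ y) (hx2 : √3 * y < x) (hx1 : x < d / 2) :
    A + (y • b 0 + x • b 1) ∈ convexHull ℝ 
      {A, A + d • b 1, A + ((√3 * d / 2) • b 0 + (d / 2) • b 1)} := by
  have s0 : 0 < √3 := by positivity
  have s3 : √3 * √3 = 3 := mul_self_sqrt (by norm_num)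
  generalize √3 = s at *
  generalize b 0 = e at *
  generalize b 1 = f at *
  refine mem_convexHull_of_exists_fintype (ι := Fin 3)
      ![1 - x / d - s * y / (3 * d), x / d - s * y / (3 * d), 2 * s * y / (3 * d)]
      ![A, A + d • f, A + ((s * d / 2) • e + (d / 2) • f)] ?_ ?_ ?_ ?_
  · have c0 : 0 ≤ 1 - x / d - s * y / (3 * d) := by
      rw [show 1 - x / d - s * y / (3 * d) = (3 * d - 3 * x - s * y) / (3 * d) by field_simp]
      apply div_nonneg <;> linarith
    have c1 : 0 ≤ x / d - s * y / (3 * d) := by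
      rw [show x / d - s * y / (3 * d) = (3 * x - s * y) / (3 * d) by field_simp]
      have : 0 ≤ s * y := by positivity
      apply div_nonneg <;> linarith
    have c2 : 0 ≤ 2 * s * y / (3 * d) := by positivity
    intro i
    fin_cases i
    · exact c0
    · exact c1
    · exact c2
  · rw [Fin.sum_univ_three]
    change 1 - x / d - s * y / (3 * d) + (x / d - s * y / (3 * d)) + 2 * s * y / (3 * d) = 1
    ring
  · intro i; fin_cases i <;> simp
  · rw [Fin.sum_univ_three]
    change (1 - x / d - s * y / (3 * d)) • A + (x / d - s * y / (3 * d)) • (A + d • f) +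
      (2 * s * y / (3 * d)) • (A + ((s * d / 2) • e + (d / 2) • f)) = _
    match_scalars
    · ring
    · field_simp; ring
    · field_simp; linear_combination y * s3

lemma cell_vol (R d : ℝ) (hR : 0 < R) (h1 : √3 / 2 ≤ d / (2 * R)) (h2 : d / (2 * R) ≤ 1) (A B C : (EuclideanSpace ℝ (Fin 2)))
    (hAB : dist A B = d) (hBC : dist B C = d) (hAC : dist A C = d) :
    volume (cell R A B C) = ENNReal.ofReal (R ^ 2 * (π / 12 - arccos (d / (2 * R)) / 2 + 
      d / (2 * R) * √(1 - (d / (2 * R)) ^ 2) / 2)) := by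
  have s0 : 0 < √3 := by positivity
  have s3 : √3 * √3 = 3 := mul_self_sqrt (by norm_num)
  have hβ : 0 < d / (2 * R) := by linarith [s0]
  have hd : 0 < d := by
    rw [lt_div_iff₀ (by positivity)] at hβ; linarith
  obtain ⟨b, rfl, rfl⟩ := exists_frame d hd A B C hAB hBC hAC
  rw [← aux_region R _ hR h1 h2, ← (frame_mp b A).measure_preimage (cell_meas _ _ _ _).nullMeasurableSet]
  congr 1
  ext ⟨y, x⟩
  have eA := frame_dist b A x y 0 0
  have eB := frame_dist b A x y d 0
  have eC := frame_dist b A x y (d / 2) (√3 * d / 2)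
  simp only [zero_smul, add_zero, zero_add] at eA eB
  simp only [cell, Set.mem_preimage, Set.mem_ofPred_eq, regionBetween, eA, eB, eC, Set.mem_Ico, Set.mem_Ioo]
  rw [sqrt_lt_sqrt_iff (by positivity), sqrt_lt_sqrt_iff (by positivity), sqrt_lt' hR,
    lt_min_iff, show d / (2 * R) * R = d / 2 by field_simp]
  constructor
  · rintro ⟨hh, ha, hb, hc⟩
    have hy : 0 ≤ y := by
      have hcv : Convex ℝ {p : (EuclideanSpace ℝ (Fin 2)) | inner ℝ (b 0) A ≤ inner ℝ (b 0) p} :=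
        convex_halfSpace_ge (innerₛₗ ℝ (b 0)).isLinear _
      have := convexHull_min (t := {p : (EuclideanSpace ℝ (Fin 2)) | inner ℝ (b 0) A ≤ inner ℝ (b 0) p}) ?_ hcv hh
      · simpa [inner_add_right, inner_smul_right, b.inner_eq_ite] using this
      · rintro p (rfl | rfl | rfl) <;>
          simp [inner_add_right, inner_smul_right, b.inner_eq_ite] <;> positivity
    have hx1 : x < d / 2 := by nlinarith
    have hx2 : √3 * y < x := by nlinarith
    have := mul_self_lt_mul_self (by positivity) hx2
    refine ⟨⟨hy, ?_⟩, hx2, hx1, ?_⟩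
    · nlinarith
    · apply lt_sqrt_of_sq_lt; nlinarith
  · rintro ⟨⟨hy, hy2⟩, hx2, hx1, hx3⟩
    have hx0 : 0 ≤ x := le_trans (by positivity) hx2.le
    rw [lt_sqrt hx0] at hx3
    refine ⟨?_, by nlinarith, by nlinarith, by nlinarith⟩
    exact frame_hull d hd b A x y hy hx2 hx1

lemma bis_null (A B : (EuclideanSpace ℝ (Fin 2))) (h : A ≠ B) : volume {p : (EuclideanSpace ℝ (Fin 2)) | dist p A = dist p B} = 0 := by
  have := Measure.addHaar_affineSubspace (volume : Measure (EuclideanSpace ℝ (Fin 2))) (AffineSubspace.perpBisector A B)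
    (by simpa using h)
  convert this using 2
  ext p
  simp [AffineSubspace.mem_perpBisector_iff_dist_eq]

/-- In the overlapping regime `β = d/(2R_S) ∈ [√3/2, 1]`, the area of an equilateral
triangle of side `d` covered by the three disks of radius `R_S` at its vertices is
`R_S²·(π/2 − 3·arccos β + 3β·√(1−β²))`. -/
theorem triangle_coverage_overlap (R_S d : ℝ) (hR : 0 < R_S)
    (hβ : d / (2 * R_S) ∈ Set.Icc (Real.sqrt 3 / 2) 1)
    (A B C : EuclideanSpace ℝ (Fin 2))
    (hAB : dist A B = d) (hBC : dist B C = d) (hAC : dist A C = d) :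
    volume (convexHull ℝ {A, B, C} ∩ (ball A R_S ∪ ball B R_S ∪ ball C R_S)) =
      ENNReal.ofReal (R_S ^ 2 *
        (π / 2 - 3 * Real.arccos (d / (2 * R_S)) +
          3 * (d / (2 * R_S)) * Real.sqrt (1 - (d / (2 * R_S)) ^ 2))) := by
  have s0 : 0 < √3 := by positivity
  have hd : 0 < d := by
    have hβ : 0 < d / (2 * R_S) := by linarith [s0, hβ.1]
    rw [lt_div_iff₀ (by positivity)] at hβ; linarith
  have nAB : A ≠ B := dist_pos.1 (hAB ▸ hd)
  have nBC : B ≠ C := dist_pos.1 (hBC ▸ hd)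
  have nAC : A ≠ C := dist_pos.1 (hAC ▸ hd)
  have hBA := hAB
  have hCB := hBC
  have hCA := hAC
  rw [dist_comm] at hBA hCB hCA
  have p1 : ({A, C, B} : Set (EuclideanSpace ℝ (Fin 2))) = {A, B, C} := by ext; simp; tauto
  have p2 : ({B, A, C} : Set (EuclideanSpace ℝ (Fin 2))) = {A, B, C} := by ext; simp; tauto
  have p3 : ({B, C, A} : Set (EuclideanSpace ℝ (Fin 2))) = {A, B, C} := by ext; simp; tauto
  have p4 : ({C, A, B} : Set (EuclideanSpace ℝ (Fin 2))) = {A, B, C} := by ext; simp; tauto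
  have p5 : ({C, B, A} : Set (EuclideanSpace ℝ (Fin 2))) = {A, B, C} := by ext; simp; tauto
  have key : (convexHull ℝ {A, B, C} ∩ (ball A R_S ∪ ball B R_S ∪ ball C R_S) : Set (EuclideanSpace ℝ (Fin 2))) =ᵐ[volume]
      (cell R_S A B C ∪ (cell R_S A C B ∪ (cell R_S B A C ∪ (cell R_S B C A ∪
        (cell R_S C A B ∪ cell R_S C B A)))) : Set (EuclideanSpace ℝ (Fin 2))) := by
    rw [Filter.eventuallyEq_set]
    have n1 : ∀ᵐ p ∂(volume : Measure (EuclideanSpace ℝ (Fin 2))), dist p A ≠ dist p B := by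
      rw [ae_iff]; simpa using bis_null A B nAB
    have n2 : ∀ᵐ p ∂(volume : Measure (EuclideanSpace ℝ (Fin 2))), dist p B ≠ dist p C := by
      rw [ae_iff]; simpa using bis_null B C nBC
    have n3 : ∀ᵐ p ∂(volume : Measure (EuclideanSpace ℝ (Fin 2))), dist p A ≠ dist p C := by
      rw [ae_iff]; simpa using bis_null A C nAC
    filter_upwards [n1, n2, n3] with p h1 h2 h3
    simp only [cell, Set.mem_union, Set.mem_inter_iff, Set.mem_ofPred_eq, mem_ball, p1, p2, p3, p4, p5]
    generalize dist p A = a at *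
    generalize dist p B = b at *
    generalize dist p C = c at *
    by_cases hp : p ∈ convexHull ℝ {A, B, C}
    · simp only [hp, true_and]
      rcases lt_or_gt_of_ne h1 with h1 | h1 <;> rcases lt_or_gt_of_ne h2 with h2 | h2 <;>
        rcases lt_or_gt_of_ne h3 with h3 | h3 <;> grind
    · simp [hp]
  have v := fun X Y Z => cell_vol R_S d hR hβ.1 hβ.2 X Y Z
  have m := fun X Y Z => cell_meas R_S X Y Z
  have m5 := (m C A B).union (m C B A)
  have m4 := (m B C A).union m5
  have m3 := (m B A C).union m4
  have m2 := (m A C B).union m3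
  have dj : ∀ s t : Set (EuclideanSpace ℝ (Fin 2)), (∀ p, p ∈ s → p ∈ t → False) → Disjoint s t := fun s t h =>
    Set.disjoint_left.2 h
  rw [measure_congr key, measure_union _ m2, measure_union _ m3, measure_union _ m4,
    measure_union _ m5, measure_union _ (m C B A), v A B C hAB hBC hAC, v A C B hAC hCB hAB,
    v B A C hBA hAC hBC, v B C A hBC hCA hBA, v C A B hCA hAB hCB, v C B A hCB hBA hCA]
  · generalize arccos (d / (2 * R_S)) = a
    generalize d / (2 * R_S) = β
    rw [show R_S ^ 2 * (π / 2 - 3 * a + 3 * β * √(1 - β ^ 2)) =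
      6 * (R_S ^ 2 * (π / 12 - a / 2 + β * √(1 - β ^ 2) / 2)) by ring,
      ENNReal.ofReal_mul (p := 6) (by norm_num)]
    rw [show ENNReal.ofReal 6 = 6 by simp]
    ring
  all_goals
    apply dj
    intro p
    simp only [cell, Set.mem_union, Set.mem_ofPred_eq]
    generalize dist p A = a
    generalize dist p B = b
    generalize dist p C = c
    grind
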